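/- Let C = (C(i,j))_{1≤i,j≤p} be an np×np complex matrix partitioned into p² circulant blocks of order n, with C(i,j) = circ(c(i,j)) and c(i,j) = (c_1(i,j), …, c_n(i,j)). For 1 ≤ k ≤ n define the p×p matrix S_k by S_k(i,j) = Σ_{ℓ=1}^{n} c_ℓ(i,j) ω^{(k−1)(ℓ−1)}, where ω = exp(2πi/n). Then the set of complex eigenvalues of C equals the union over k = 1, …, n of the sets of complex eigenvalues of the matrices S_k: Σ(C) = ∪_{k=1}^{n} Σ(S_k). -/

import Mathlib

open Matrix in
lemma mem_spectrum_iff_exists_mulVec {K ι : Type*} [Field K] [Fintype ι] [DecidableEq ι]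
    (A : Matrix ι ι K) (μ : K) :
    μ ∈ spectrum K A ↔ ∃ v : ι → K, v ≠ 0 ∧ A *ᵥ v = μ • v := by
  rw [spectrum.mem_iff, Matrix.isUnit_iff_isUnit_det, isUnit_iff_ne_zero, not_not,
    ← Matrix.exists_mulVec_eq_zero_iff]
  simp only [Matrix.sub_mulVec, Algebra.algebraMap_eq_smul_one, Matrix.smul_mulVec,
    Matrix.one_mulVec, sub_eq_zero, eq_comm]

lemma pow_val_mul_val_eq_stdAddChar (n : ℕ) [NeZero n] (k l : ZMod n) :
    Complex.exp (2 * Real.pi * Complex.I / n) ^ (k.val * l.val) = ZMod.stdAddChar (k * l) := by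
  have h : k * l = (((k.val * l.val : ℕ) : ℤ) : ZMod n) := by simp
  rw [h, ZMod.stdAddChar_coe, ← Complex.exp_nat_mul]
  congr 1
  push_cast
  ring

/-- Cross-correlating with `f` multiplies the character `a ↦ χ (k * a)` by a Fourier coefficient
of `f`. -/
lemma sum_sub_mul_stdAddChar (n : ℕ) [NeZero n] (f : ZMod n → ℂ) (k a : ZMod n) :
    ∑ b, f (b - a) * ZMod.stdAddChar (k * b) =
      ZMod.stdAddChar (k * a) * ∑ l, f l * ZMod.stdAddChar (k * l) := by
  rw [Finset.mul_sum]
  refine Fintype.sum_equiv (Equiv.subRight a) _ _ fun b ↦ ?_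
  rw [Equiv.subRight_apply, mul_left_comm, ← AddChar.map_add_eq_mul]
  ring_nf

open ZMod in
/-- The discrete Fourier transform turns cross-correlation with `f` into multiplication. -/
lemma dft_sum_sub_mul (n : ℕ) [NeZero n] (f v : ZMod n → ℂ) (k : ZMod n) :
    𝓕 (fun a ↦ ∑ b, f (b - a) * v b) k =
      (∑ l, f l * stdAddChar (k * l)) * 𝓕 v k := by
  simp only [dft_apply, smul_eq_mul, Finset.mul_sum]
  rw [Finset.sum_comm]
  refine Finset.sum_congr rfl fun b _ ↦ ?_
  rw [Finset.sum_mul]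
  refine Fintype.sum_equiv (Equiv.subLeft b) _ _ fun a ↦ ?_
  have h : stdAddChar (-(a * k)) = stdAddChar (k * (b - a)) * stdAddChar (-(b * k)) := by
    rw [← AddChar.map_add_eq_mul]
    ring_nf
  rw [Equiv.subLeft_apply, h]
  ring

/-- Let `C` be an `np × np` complex matrix partitioned into `p²` circulant
blocks of order `n`, the `(i,j)` block being `circ(c(i,j))`.  For each `k` (0-indexed,
`k ∈ ZMod n`) let `S_k` be the `p × p` matrix with entries
`S_k(i,j) = ∑_ℓ c_ℓ(i,j) ω^{kℓ}`, `ω = exp(2πi/n)`.  Then the set of complex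
eigenvalues of `C` is the union of the sets of complex eigenvalues of the `S_k`. -/
theorem blockCirculant_spectrum_eq_iUnion
    (p n : ℕ) [NeZero n]
    (c : Fin p → Fin p → ZMod n → ℂ)
    (ω : ℂ) (hω : ω = Complex.exp (2 * Real.pi * Complex.I / n))
    (C : Matrix (Fin p × ZMod n) (Fin p × ZMod n) ℂ)
    (hC : ∀ (i j : Fin p) (a b : ZMod n), C (i, a) (j, b) = c i j (b - a))
    (S : ZMod n → Matrix (Fin p) (Fin p) ℂ)
    (hS : ∀ (k : ZMod n) (i j : Fin p),
      S k i j = ∑ ℓ : ZMod n, c i j ℓ * ω ^ (k.val * ℓ.val)) :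
    spectrum ℂ C = ⋃ k : ZMod n, spectrum ℂ (S k) := by
  subst hω
  simp only [pow_val_mul_val_eq_stdAddChar] at hS
  ext μ
  simp only [Set.mem_iUnion, mem_spectrum_iff_exists_mulVec]
  constructor
  · rintro ⟨v, hv, hCv⟩
    obtain ⟨k, hk⟩ : ∃ k, (fun j ↦ ZMod.dft (fun a ↦ v (j, a)) k) ≠ 0 := by
      by_contra! h
      refine hv (funext fun ⟨j, a⟩ ↦ ?_)
      have hj : ZMod.dft (fun a ↦ v (j, a)) = 0 := funext fun k ↦ congrFun (h k) j
      exact congrFun ((LinearEquiv.map_eq_zero_iff _).mp hj) a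
    refine ⟨k, _, hk, funext fun i ↦ ?_⟩
    have hi : (∑ j, fun a ↦ ∑ b, c i j (b - a) * v (j, b)) = μ • fun a ↦ v (i, a) := by
      ext a
      simpa [Matrix.mulVec, dotProduct, Fintype.sum_prod_type, hC] using congrFun hCv (i, a)
    have hdft := congrFun (congrArg ZMod.dft hi) k
    simpa [Matrix.mulVec, dotProduct, hS, dft_sum_sub_mul] using hdft
  · rintro ⟨k, u, hu, hSu⟩
    refine ⟨fun x ↦ ZMod.stdAddChar (k * x.2) * u x.1, fun h ↦ hu (funext fun j ↦ ?_),
      funext fun ⟨i, a⟩ ↦ ?_⟩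
    · simpa using congrFun h (j, 0)
    · have hi : ∑ j, S k i j * u j = μ * u i := congrFun hSu i
      simp only [Matrix.mulVec, dotProduct, Fintype.sum_prod_type, hC, Pi.smul_apply, smul_eq_mul,
        ← mul_assoc, ← Finset.sum_mul, sum_sub_mul_stdAddChar, ← hS]
      simp only [mul_assoc, ← Finset.mul_sum, hi]
      ring
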